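/- Let k be an algebraically closed field with char k ≠ 2, and let a, b, c ∈ k with c ≠ 0. Define T = k⟨x,y,z⟩/⟨xy − yx, zx − a·x² − b·xy − c·y² − xz, zy − a·xy − b·y² − yz⟩. Then: T is graded-isomorphic to L(1,0) if a ≠ 0; T is graded-isomorphic to L(0,0) if a = 0 and b = 0; and T is graded-isomorphic to L(0,1) if a = 0 and b ≠ 0. Moreover, the algebras L(0,0), L(0,1), and L(1,0) are pairwise non-isomorphic as graded algebras. -/

import Mathlib

noncomputable section

/-- The free algebra on three generators `x, y, z` (indexed by `Fin 3`). -/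
abbrev F3 (k : Type) [Field k] : Type := FreeAlgebra k (Fin 3)

noncomputable def X (k : Type) [Field k] : F3 k := FreeAlgebra.ι k 0
noncomputable def Y (k : Type) [Field k] : F3 k := FreeAlgebra.ι k 1
noncomputable def Z (k : Type) [Field k] : F3 k := FreeAlgebra.ι k 2

/-- The quotient of the free algebra on `x, y, z` by the two-sided ideal
generated by the set `rels`. -/
abbrev quotAlg (k : Type) [Field k] (rels : Set (F3 k)) : Type :=
  RingQuot (fun a b : F3 k => a ∈ rels ∧ b = 0)

/-- The image of the `i`-th generator in the quotient algebra. -/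
noncomputable def gen (k : Type) [Field k] (rels : Set (F3 k)) (i : Fin 3) :
    quotAlg k rels :=
  RingQuot.mkAlgHom k (fun a b : F3 k => a ∈ rels ∧ b = 0) (FreeAlgebra.ι k i)

/-- The `k`-linear span of the images of the generators in the quotient. -/
noncomputable def genSpan (k : Type) [Field k] (rels : Set (F3 k)) :
    Submodule k (quotAlg k rels) :=
  Submodule.span k (Set.range (gen k rels))

/-- There is a graded isomorphism between the two quotient algebras:
a `k`-algebra isomorphism carrying the span of the generators onto the
span of the generators. -/
def GradedIso (k : Type) [Field k] (r1 r2 : Set (F3 k)) : Prop :=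
  ∃ φ : quotAlg k r1 ≃ₐ[k] quotAlg k r2,
    Submodule.map φ.toLinearMap (genSpan k r1) = genSpan k r2

/-- Relations of `L(ε₁,ε₂) = k⟨x,y,z⟩/⟨xy − yx, zx − xz + ε₁·xy + ε₂·x², zy − yz + x² + ε₁·y² + ε₂·xy⟩`. -/
noncomputable def Lrel (k : Type) [Field k] (ε₁ ε₂ : k) : Set (F3 k) :=
  {X k * Y k - Y k * X k,
   Z k * X k - X k * Z k + ε₁ • (X k * Y k) + ε₂ • X k ^ 2,
   Z k * Y k - Y k * Z k + X k ^ 2 + ε₁ • Y k ^ 2 + ε₂ • (X k * Y k)}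

/-- Relations of `T = k⟨x,y,z⟩/⟨xy − yx, zx − a·x² − b·xy − c·y² − xz, zy − a·xy − b·y² − yz⟩`. -/
noncomputable def TLrel (k : Type) [Field k] (a b c : k) : Set (F3 k) :=
  {X k * Y k - Y k * X k,
   Z k * X k - a • X k ^ 2 - b • (X k * Y k) - c • Y k ^ 2 - X k * Z k,
   Z k * Y k - a • (X k * Y k) - b • Y k ^ 2 - Y k * Z k}

section Presentation

variable {k : Type} [Field k] {rels : Set (F3 k)}

theorem mkAlgHom_eq_zero_of_mem {w : F3 k} (hw : w ∈ rels) :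
    RingQuot.mkAlgHom k (fun a b : F3 k => a ∈ rels ∧ b = 0) w = 0 := by
  have h := RingQuot.mkAlgHom_rel k (s := fun a b : F3 k => a ∈ rels ∧ b = 0) (x := w) (y := 0)
    ⟨hw, rfl⟩
  rwa [map_zero] at h

/-- The universal property of the quotient algebra. -/
def quotLift {B : Type} [Ring B] [Algebra k B] (f : Fin 3 → B)
    (hf : ∀ w ∈ rels, FreeAlgebra.lift k f w = 0) : quotAlg k rels →ₐ[k] B :=
  RingQuot.liftAlgHom k ⟨FreeAlgebra.lift k f, by
    rintro a b ⟨ha, rfl⟩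
    rw [hf a ha, map_zero]⟩

@[simp]
theorem quotLift_gen {B : Type} [Ring B] [Algebra k B] (f : Fin 3 → B)
    (hf : ∀ w ∈ rels, FreeAlgebra.lift k f w = 0) (i : Fin 3) :
    quotLift f hf (gen k rels i) = f i := by
  simp [quotLift, gen]

theorem quotAlg_algHom_ext {B : Type} [Ring B] [Algebra k B] {f g : quotAlg k rels →ₐ[k] B}
    (h : ∀ i, f (gen k rels i) = g (gen k rels i)) : f = g := by
  apply RingQuot.ringQuot_ext'
  apply FreeAlgebra.hom_ext
  funext i
  exact h i

theorem gen_mem_genSpan (i : Fin 3) : gen k rels i ∈ genSpan k rels :=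
  Submodule.subset_span ⟨i, rfl⟩

theorem gradedIso_of_mutually_inverse {r1 r2 : Set (F3 k)}
    (f : quotAlg k r1 →ₐ[k] quotAlg k r2) (g : quotAlg k r2 →ₐ[k] quotAlg k r1)
    (hf : ∀ i, f (gen k r1 i) ∈ genSpan k r2) (hg : ∀ i, g (gen k r2 i) ∈ genSpan k r1)
    (hfg : ∀ i, f (g (gen k r2 i)) = gen k r2 i) (hgf : ∀ i, g (f (gen k r1 i)) = gen k r1 i) :
    GradedIso k r1 r2 := by
  refine ⟨AlgEquiv.ofAlgHom f g (quotAlg_algHom_ext hfg) (quotAlg_algHom_ext hgf), ?_⟩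
  apply le_antisymm
  · rw [genSpan, Submodule.map_span_le]
    rintro _ ⟨i, rfl⟩
    exact hf i
  · rw [genSpan, Submodule.span_le]
    rintro _ ⟨i, rfl⟩
    exact ⟨g (gen k r2 i), hg i, hfg i⟩

end Presentation

section Relations

variable {k : Type} [Field k]

theorem lift_Lrel_eq_zero {B : Type} [Ring B] [Algebra k B] {ε₁ ε₂ : k} {f : Fin 3 → B}
    (hxy : f 0 * f 1 - f 1 * f 0 = 0)
    (hzx : f 2 * f 0 - f 0 * f 2 + ε₁ • (f 0 * f 1) + ε₂ • f 0 ^ 2 = 0)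
    (hzy : f 2 * f 1 - f 1 * f 2 + f 0 ^ 2 + ε₁ • f 1 ^ 2 + ε₂ • (f 0 * f 1) = 0) :
    ∀ w ∈ Lrel k ε₁ ε₂, FreeAlgebra.lift k f w = 0 := by
  rintro w (rfl | rfl | rfl) <;> simpa [X, Y, Z]

theorem lift_TLrel_eq_zero {B : Type} [Ring B] [Algebra k B] {a b c : k} {f : Fin 3 → B}
    (hxy : f 0 * f 1 - f 1 * f 0 = 0)
    (hzx : f 2 * f 0 - a • f 0 ^ 2 - b • (f 0 * f 1) - c • f 1 ^ 2 - f 0 * f 2 = 0)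
    (hzy : f 2 * f 1 - a • (f 0 * f 1) - b • f 1 ^ 2 - f 1 * f 2 = 0) :
    ∀ w ∈ TLrel k a b c, FreeAlgebra.lift k f w = 0 := by
  rintro w (rfl | rfl | rfl) <;> simpa [X, Y, Z]

theorem Lrel_gen_relations (ε₁ ε₂ : k) :
    let g := gen k (Lrel k ε₁ ε₂)
    g 1 * g 0 = g 0 * g 1 ∧
    g 2 * g 0 = g 0 * g 2 - ε₁ • (g 0 * g 1) - ε₂ • (g 0 * g 0) ∧
    g 2 * g 1 = g 1 * g 2 - g 0 * g 0 - ε₁ • (g 1 * g 1) - ε₂ • (g 0 * g 1) := by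
  have h1 := mkAlgHom_eq_zero_of_mem (rels := Lrel k ε₁ ε₂) (Or.inl rfl)
  have h2 := mkAlgHom_eq_zero_of_mem (rels := Lrel k ε₁ ε₂) (Or.inr (Or.inl rfl))
  have h3 := mkAlgHom_eq_zero_of_mem (rels := Lrel k ε₁ ε₂) (Or.inr (Or.inr rfl))
  simp only [X, Y, Z, map_add, map_sub, map_mul, map_smul, ← gen.eq_1, sq] at h1 h2 h3
  refine ⟨(sub_eq_zero.mp h1).symm, ?_, ?_⟩ <;> rw [← sub_eq_zero]
  · rw [← h2]; abel
  · rw [← h3]; abel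

theorem TLrel_gen_relations (a b c : k) :
    let g := gen k (TLrel k a b c)
    g 1 * g 0 = g 0 * g 1 ∧
    g 2 * g 0 = g 0 * g 2 + a • (g 0 * g 0) + b • (g 0 * g 1) + c • (g 1 * g 1) ∧
    g 2 * g 1 = g 1 * g 2 + a • (g 0 * g 1) + b • (g 1 * g 1) := by
  have h1 := mkAlgHom_eq_zero_of_mem (rels := TLrel k a b c) (Or.inl rfl)
  have h2 := mkAlgHom_eq_zero_of_mem (rels := TLrel k a b c) (Or.inr (Or.inl rfl))
  have h3 := mkAlgHom_eq_zero_of_mem (rels := TLrel k a b c) (Or.inr (Or.inr rfl))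
  simp only [X, Y, Z, map_sub, map_mul, map_smul, ← gen.eq_1, sq] at h1 h2 h3
  refine ⟨(sub_eq_zero.mp h1).symm, ?_, ?_⟩ <;> rw [← sub_eq_zero]
  · rw [← h2]; abel
  · rw [← h3]; abel

theorem lift_TLrel_linear_eq_zero {B : Type} [Ring B] [Algebra k B] {a b c ε₁ ε₂ p q r : k}
    {x y z : B} (hp : p ≠ 0) (hq : q ≠ 0)
    (ha : ε₁ * q = a) (hb : ε₁ * r + ε₂ * p = b) (hc : p ^ 2 = q * c)
    (hyx : y * x = x * y) (hzx : z * x = x * z - ε₁ • (x * y) - ε₂ • (x * x))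
    (hzy : z * y = y * z - x * x - ε₁ • (y * y) - ε₂ • (x * y)) :
    ∀ w ∈ TLrel k a b c,
      FreeAlgebra.lift k ![q⁻¹ • y - (q⁻¹ * r * p⁻¹) • x, p⁻¹ • x, -z] w = 0 := by
  obtain rfl : c = q⁻¹ * p ^ 2 := by rw [hc]; field_simp
  subst ha hb
  apply lift_TLrel_eq_zero
  all_goals
    simp only [Matrix.cons_val, sq, mul_sub, sub_mul, smul_mul_assoc, mul_smul_comm, neg_mul,
      mul_neg, hyx, hzx, hzy]
    match_scalars <;> field_simp <;> ring

theorem lift_Lrel_linear_eq_zero {B : Type} [Ring B] [Algebra k B] {a b c ε₁ ε₂ p q r : k}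
    {x y z : B} (ha : ε₁ * q = a) (hb : ε₁ * r + ε₂ * p = b) (hc : p ^ 2 = q * c)
    (hyx : y * x = x * y) (hzx : z * x = x * z + a • (x * x) + b • (x * y) + c • (y * y))
    (hzy : z * y = y * z + a • (x * y) + b • (y * y)) :
    ∀ w ∈ Lrel k ε₁ ε₂, FreeAlgebra.lift k ![p • y, q • x + r • y, -z] w = 0 := by
  apply lift_Lrel_eq_zero
  all_goals
    simp only [Matrix.cons_val, sq, mul_add, add_mul, smul_mul_assoc, mul_smul_comm, neg_mul,
      mul_neg, hyx, hzx, hzy]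
    match_scalars <;> grind

/-- The substitution `X = p y`, `Y = q x + r y`, `Z = -z` turns the relations of `T` into those of
`L(ε₁, ε₂)` as soon as the coefficients match. -/
theorem gradedIso_TLrel_Lrel {a b c ε₁ ε₂ p q r : k} (hp : p ≠ 0) (hq : q ≠ 0)
    (ha : ε₁ * q = a) (hb : ε₁ * r + ε₂ * p = b) (hc : p ^ 2 = q * c) :
    GradedIso k (TLrel k a b c) (Lrel k ε₁ ε₂) := by
  obtain ⟨t1, t2, t3⟩ := TLrel_gen_relations a b c
  obtain ⟨l1, l2, l3⟩ := Lrel_gen_relations ε₁ ε₂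
  let f : quotAlg k (TLrel k a b c) →ₐ[k] quotAlg k (Lrel k ε₁ ε₂) :=
    quotLift _ (lift_TLrel_linear_eq_zero hp hq ha hb hc l1 l2 l3)
  let g : quotAlg k (Lrel k ε₁ ε₂) →ₐ[k] quotAlg k (TLrel k a b c) :=
    quotLift _ (lift_Lrel_linear_eq_zero ha hb hc t1 t2 t3)
  have hT := gen_mem_genSpan (k := k) (rels := TLrel k a b c)
  have hL := gen_mem_genSpan (k := k) (rels := Lrel k ε₁ ε₂)
  refine gradedIso_of_mutually_inverse f g ?_ ?_ ?_ ?_ <;> intro i <;> fin_cases i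
  · simpa [f] using sub_mem (Submodule.smul_mem _ _ (hL 1)) (Submodule.smul_mem _ _ (hL 0))
  · simpa [f] using Submodule.smul_mem _ _ (hL 0)
  · simpa [f] using hL 2
  · simpa [g] using Submodule.smul_mem _ _ (hT 1)
  · simpa [g] using add_mem (Submodule.smul_mem _ _ (hT 0)) (Submodule.smul_mem _ _ (hT 1))
  · simpa [g] using hT 2
  all_goals
    simp [f, g, smul_smul, smul_sub]
    try (match_scalars <;> field_simp <;> ring)

end Relations

section Representation

variable {k : Type} [Field k]

/-- The matrix of `α x + β y + γ z` acting on polynomials of degree at most two in `x, y`, in the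
basis `1, x, y, x², xy, y²`; here `x` and `y` act by multiplication, `z` acts by the derivation
`-(ε₁ y + ε₂ x)(x ∂x + y ∂y) - x² ∂y`, and terms of degree three are dropped. -/
def linearFormMatrix (ε₁ ε₂ α β γ : k) : Matrix (Fin 6) (Fin 6) k :=
  !![0, 0, 0, 0, 0, 0;
     α, 0, 0, 0, 0, 0;
     β, 0, 0, 0, 0, 0;
     0, α - γ * ε₂, -γ, 0, 0, 0;
     0, β - γ * ε₁, α - γ * ε₂, 0, 0, 0;
     0, 0, β - γ * ε₁, 0, 0, 0]

theorem linearFormMatrix_mul (ε₁ ε₂ α β γ α' β' γ' : k) :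
    linearFormMatrix ε₁ ε₂ α β γ * linearFormMatrix ε₁ ε₂ α' β' γ' =
      !![0, 0, 0, 0, 0, 0;
         0, 0, 0, 0, 0, 0;
         0, 0, 0, 0, 0, 0;
         (α - γ * ε₂) * α' - γ * β', 0, 0, 0, 0, 0;
         (β - γ * ε₁) * α' + (α - γ * ε₂) * β', 0, 0, 0, 0, 0;
         (β - γ * ε₁) * β', 0, 0, 0, 0, 0] := by
  ext i j
  fin_cases i <;> fin_cases j <;>
    simp [linearFormMatrix, Matrix.mul_apply, Fin.sum_univ_succ]; ring

/-- The representation of `L(ε₁, ε₂)` on polynomials of degree at most two. -/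
def Lrep (ε₁ ε₂ : k) : quotAlg k (Lrel k ε₁ ε₂) →ₐ[k] Matrix (Fin 6) (Fin 6) k :=
  quotLift ![linearFormMatrix ε₁ ε₂ 1 0 0, linearFormMatrix ε₁ ε₂ 0 1 0,
    linearFormMatrix ε₁ ε₂ 0 0 1] <| by
      apply lift_Lrel_eq_zero
      all_goals
        simp only [sq, Matrix.cons_val, linearFormMatrix_mul]
        ext i j
        fin_cases i <;> fin_cases j <;> simp

theorem Lrep_sum_gen (ε₁ ε₂ : k) (v : Fin 3 → k) :
    Lrep ε₁ ε₂ (∑ j, v j • gen k _ j) = linearFormMatrix ε₁ ε₂ (v 0) (v 1) (v 2) := by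
  simp only [Fin.sum_univ_three, map_add, map_smul, Lrep, quotLift_gen]
  ext i j
  fin_cases i <;> fin_cases j <;> simp [linearFormMatrix] <;> ring

theorem linearIndependent_gen_Lrel (ε₁ ε₂ : k) :
    LinearIndependent k (gen k (Lrel k ε₁ ε₂)) := by
  rw [Fintype.linearIndependent_iff]
  intro v hv
  have h := Lrep_sum_gen ε₁ ε₂ v
  rw [hv, map_zero] at h
  have h0 := congrFun (congrFun h 1) 0
  have h1 := congrFun (congrFun h 2) 0
  have h2 := congrFun (congrFun h 3) 2
  simp [linearFormMatrix] at h0 h1 h2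
  intro i
  fin_cases i <;> simp [← h0, ← h1, h2]

/-- The matrix of a graded isomorphism between two of the algebras `L` is invertible, and the images of the
generators satisfy the relations of the source in the representation of the target. -/
theorem GradedIso.exists_matrix {ε₁ ε₂ ε₁' ε₂' : k}
    (h : GradedIso k (Lrel k ε₁ ε₂) (Lrel k ε₁' ε₂')) :
    ∃ M : Matrix (Fin 3) (Fin 3) k, M.det ≠ 0 ∧
      let x := linearFormMatrix ε₁' ε₂' (M 0 0) (M 0 1) (M 0 2)
      let y := linearFormMatrix ε₁' ε₂' (M 1 0) (M 1 1) (M 1 2)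
      let z := linearFormMatrix ε₁' ε₂' (M 2 0) (M 2 1) (M 2 2)
      y * x = x * y ∧ z * x = x * z - ε₁ • (x * y) - ε₂ • (x * x) ∧
        z * y = y * z - x * x - ε₁ • (y * y) - ε₂ • (x * y) := by
  obtain ⟨φ, hφ⟩ := h
  have hM : ∀ i, ∃ v : Fin 3 → k, ∑ j, v j • gen k _ j = φ (gen k (Lrel k ε₁ ε₂) i) := fun i => by
    rw [← Submodule.mem_span_range_iff_exists_fun]
    exact hφ.le ⟨_, gen_mem_genSpan i, rfl⟩
  have hN : ∀ i, ∃ v : Fin 3 → k, φ (∑ j, v j • gen k _ j) = gen k (Lrel k ε₁' ε₂') i := fun i => by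
    obtain ⟨u, hu, hui⟩ := hφ.ge (gen_mem_genSpan i)
    obtain ⟨v, rfl⟩ := (Submodule.mem_span_range_iff_exists_fun k).mp hu
    exact ⟨v, hui⟩
  choose M hM using hM
  choose N hN using hN
  refine ⟨Matrix.of M, ?_, ?_⟩
  · have hNM : Matrix.of N * Matrix.of M = 1 := by
      ext i j
      have hind := Fintype.linearIndependent_iff.mp (linearIndependent_gen_Lrel ε₁' ε₂')
        (fun j => (Matrix.of N * Matrix.of M) i j - (1 : Matrix (Fin 3) (Fin 3) k) i j) ?_ j
      · exact sub_eq_zero.mp hind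
      · simp only [sub_smul, Finset.sum_sub_distrib, Matrix.one_apply, ite_smul, one_smul,
          zero_smul, Finset.sum_ite_eq, Finset.mem_univ, if_true]
        rw [sub_eq_zero]
        conv_rhs => rw [← hN i]
        simp only [map_sum, map_smul, ← hM, Matrix.mul_apply, Matrix.of_apply, Finset.sum_smul,
          Finset.smul_sum, smul_smul]
        exact Finset.sum_comm
    intro h0
    have := congrArg Matrix.det hNM
    simp [Matrix.det_mul, h0] at this
  · obtain ⟨l1, l2, l3⟩ := Lrel_gen_relations ε₁ ε₂
    have hrep : ∀ i, linearFormMatrix ε₁' ε₂' (M i 0) (M i 1) (M i 2) =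
        Lrep ε₁' ε₂' (φ (gen k _ i)) := fun i => by rw [← hM, Lrep_sum_gen]
    simp only [Matrix.of_apply, hrep, ← map_mul, ← map_sub, ← map_smul, l1, l2, l3, and_self]

theorem not_gradedIso_L00_L01 : ¬ GradedIso k (Lrel k 0 0) (Lrel k 0 1) := by
  intro h
  obtain ⟨M, hdet, h1, h2, -⟩ := h.exists_matrix
  simp only [linearFormMatrix_mul] at h1 h2
  have a3 := congrFun (congrFun h1 3) 0
  have a4 := congrFun (congrFun h1 4) 0
  have b3 := congrFun (congrFun h2 3) 0
  have b4 := congrFun (congrFun h2 4) 0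
  simp at a3 a4 b3 b4
  rw [Matrix.det_fin_three] at hdet
  grind

theorem not_gradedIso_L00_L10 : ¬ GradedIso k (Lrel k 0 0) (Lrel k 1 0) := by
  intro h
  obtain ⟨M, hdet, h1, h2, -⟩ := h.exists_matrix
  simp only [linearFormMatrix_mul] at h1 h2
  have a4 := congrFun (congrFun h1 4) 0
  have a5 := congrFun (congrFun h1 5) 0
  have b4 := congrFun (congrFun h2 4) 0
  have b5 := congrFun (congrFun h2 5) 0
  simp at a4 a5 b4 b5
  rw [Matrix.det_fin_three] at hdet
  grind

theorem not_gradedIso_L01_L10 : ¬ GradedIso k (Lrel k 0 1) (Lrel k 1 0) := by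
  intro h
  obtain ⟨M, hdet, h1, h2, -⟩ := h.exists_matrix
  simp only [linearFormMatrix_mul] at h1 h2
  have a4 := congrFun (congrFun h1 4) 0
  have a5 := congrFun (congrFun h1 5) 0
  have b3 := congrFun (congrFun h2 3) 0
  have b4 := congrFun (congrFun h2 4) 0
  have b5 := congrFun (congrFun h2 5) 0
  simp at a4 a5 b3 b4 b5
  rw [Matrix.det_fin_three] at hdet
  grind

end Representation

theorem stmt11 (k : Type) [Field k] [IsAlgClosed k] (hchar : ringChar k ≠ 2)
    (a b c : k) (hc : c ≠ 0) :
    (a ≠ 0 → GradedIso k (TLrel k a b c) (Lrel k 1 0)) ∧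
    (a = 0 → b = 0 → GradedIso k (TLrel k a b c) (Lrel k 0 0)) ∧
    (a = 0 → b ≠ 0 → GradedIso k (TLrel k a b c) (Lrel k 0 1)) ∧
    ¬ GradedIso k (Lrel k 0 0) (Lrel k 0 1) ∧
    ¬ GradedIso k (Lrel k 0 0) (Lrel k 1 0) ∧
    ¬ GradedIso k (Lrel k 0 1) (Lrel k 1 0) := by
  refine ⟨fun ha => ?_, fun ha hb => ?_, fun ha hb => ?_, not_gradedIso_L00_L01,
    not_gradedIso_L00_L10, not_gradedIso_L01_L10⟩
  · obtain ⟨p, hp⟩ := IsAlgClosed.exists_pow_nat_eq (a * c) zero_lt_two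
    have hp0 : p ≠ 0 := by
      rintro rfl
      exact mul_ne_zero ha hc (by simpa using hp.symm)
    exact gradedIso_TLrel_Lrel (r := b) hp0 ha (one_mul a) (by ring) hp
  · exact gradedIso_TLrel_Lrel (p := 1) (q := c⁻¹) (r := 0) one_ne_zero (inv_ne_zero hc)
      (by simp [ha]) (by simp [hb]) (by field_simp)
  · exact gradedIso_TLrel_Lrel (p := b) (q := b ^ 2 / c) (r := 0) hb
      (div_ne_zero (pow_ne_zero 2 hb) hc) (by simp [ha]) (by simp) (by field_simp)
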